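/- Let G be a minimally imperfect graph with a skew partition A, B, C, D. Then every stable set of G of cardinality α(G) intersects A ∪ B. -/

import Mathlib

open SimpleGraph

/-- A graph is perfect if, in every induced subgraph, the clique number equals
the chromatic number. -/
def IsPerfect {V : Type*} (G : SimpleGraph V) : Prop :=
  ∀ S : Set V, ((G.induce S).cliqueNum : ℕ∞) = (G.induce S).chromaticNumber

/-- A graph is minimally imperfect if it is not perfect but every proper induced
subgraph of it is perfect. -/
def MinimallyImperfect {V : Type*} (G : SimpleGraph V) : Prop :=
  ¬ IsPerfect G ∧ ∀ S : Set V, S ≠ Set.univ → IsPerfect (G.induce S)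

/-- `A, B, C, D` form a skew partition of `G`: all four sets are nonempty, they
partition the vertex set, every vertex of `A` is adjacent to every vertex of `B`,
and there are no edges between `C` and `D`. -/
def IsSkewPartition {V : Type*} (G : SimpleGraph V) (A B C D : Set V) : Prop :=
  A.Nonempty ∧ B.Nonempty ∧ C.Nonempty ∧ D.Nonempty ∧
  A ∪ B ∪ C ∪ D = Set.univ ∧
  Disjoint A B ∧ Disjoint A C ∧ Disjoint A D ∧
  Disjoint B C ∧ Disjoint B D ∧ Disjoint C D ∧
  (∀ a ∈ A, ∀ b ∈ B, G.Adj a b) ∧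
  (∀ c ∈ C, ∀ d ∈ D, ¬ G.Adj c d)

/-- A graph has a skew partition if its vertex set admits one. -/
def HasSkewPartition {V : Type*} (G : SimpleGraph V) : Prop :=
  ∃ A B C D : Set V, IsSkewPartition G A B C D

/-- The stability number: the cardinality of a largest stable set, i.e. the clique
number of the complement. -/
noncomputable def stableNum {V : Type*} (G : SimpleGraph V) : ℕ :=
  Gᶜ.cliqueNum

section

open Finset

/-- `c` restricts to a proper colouring of the subgraph induced on `Y`, with colours below `k`. -/
def ProperOn {V : Type*} (G : SimpleGraph V) (Y : Finset V) (k : ℕ) (c : V → ℕ) : Prop :=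
  (∀ v ∈ Y, c v < k) ∧ ∀ u ∈ Y, ∀ v ∈ Y, G.Adj u v → c u ≠ c v

/-- `Y` contains a clique and has a proper colouring with as many colours as that clique has
vertices. -/
def CliqueColorable {V : Type*} (G : SimpleGraph V) (Y : Finset V) : Prop :=
  ∃ Q ⊆ Y, G.IsClique (Q : Set V) ∧ ∃ c, ProperOn G Y #Q c

lemma ProperOn.mono {V : Type*} {G : SimpleGraph V} {Y : Finset V} {k l : ℕ} {c : V → ℕ}
    (h : ProperOn G Y k c) (hkl : k ≤ l) : ProperOn G Y l c :=
  ⟨fun v hv => (h.1 v hv).trans_le hkl, h.2⟩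

lemma ProperOn.injOn {V : Type*} {G : SimpleGraph V} {Y K : Finset V} {k : ℕ} {c : V → ℕ}
    (h : ProperOn G Y k c) (hK : G.IsClique (K : Set V)) (hKY : K ⊆ Y) :
    Set.InjOn c (K : Set V) := fun u hu v hv huv => by
  by_contra hne
  exact h.2 u (hKY hu) v (hKY hv) (hK hu hv hne) huv

variable {V : Type*} {G : SimpleGraph V}

lemma ProperOn.exists_mem_of_card_eq {Y K : Finset V} {k : ℕ} {c : V → ℕ}
    (h : ProperOn G Y k c) (hK : G.IsClique (K : Set V)) (hKY : K ⊆ Y) (hcard : #K = k)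
    {i : ℕ} (hi : i < k) : ∃ u ∈ K, c u = i := by
  classical
  have himg : K.image c = range k := by
    apply eq_of_subset_of_card_le
    · intro j hj
      obtain ⟨u, hu, rfl⟩ := mem_image.1 hj
      exact mem_range.2 (h.1 u (hKY hu))
    · rw [card_image_of_injOn (h.injOn hK hKY), card_range, hcard]
  have : i ∈ K.image c := himg ▸ mem_range.2 hi
  simpa using this

lemma ProperOn.card_filter_le {Y K : Finset V} {k : ℕ} {c : V → ℕ} {I : Finset ℕ}
    (h : ProperOn G Y k c) (hK : G.IsClique (K : Set V)) (hKY : K ⊆ Y) :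
    #{u ∈ K | c u ∈ I} ≤ #I :=
  card_le_card_of_injOn c (fun _ hu => (mem_filter.1 hu).2)
    ((h.injOn hK hKY).mono fun _ hu => (mem_filter.1 hu).1)

lemma ProperOn.card_filter_eq {Y K : Finset V} {k : ℕ} {c : V → ℕ} {I : Finset ℕ}
    (h : ProperOn G Y k c) (hK : G.IsClique (K : Set V)) (hKY : K ⊆ Y) (hcard : #K = k)
    (hI : I ⊆ range k) : #{u ∈ K | c u ∈ I} = #I := by
  apply le_antisymm (h.card_filter_le hK hKY)
  apply card_le_card_of_surjOn c
  intro i hi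
  obtain ⟨u, hu, rfl⟩ := h.exists_mem_of_card_eq hK hKY hcard (mem_range.1 (hI hi))
  exact ⟨u, by simpa using ⟨hu, hi⟩, rfl⟩

lemma ProperOn.isClique_compl_fiber {Y : Finset V} {k : ℕ} {c : V → ℕ} (h : ProperOn G Y k c)
    (i : ℕ) : Gᶜ.IsClique (({u ∈ Y | c u = i} : Finset V) : Set V) := by
  intro u hu v hv hne
  simp only [coe_filter, Set.mem_ofPred_eq] at hu hv
  exact (SimpleGraph.compl_adj ..).2 ⟨hne, fun hadj => h.2 u hu.1 v hv.1 hadj (hu.2.trans hv.2.symm)⟩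

lemma ProperOn.card_eq_sum {Y : Finset V} {k : ℕ} {c : V → ℕ} (h : ProperOn G Y k c) :
    #Y = ∑ i ∈ range k, #{u ∈ Y | c u = i} :=
  card_eq_sum_card_fiberwise fun u hu => mem_coe.2 (mem_range.2 (h.1 u hu))

lemma ProperOn.card_le_mul {X : Finset V} {k l : ℕ} {c : V → ℕ} (h : ProperOn G X k c)
    (hl : ∀ S ⊆ X, Gᶜ.IsClique (S : Set V) → #S ≤ l) : #X ≤ l * k := by
  rw [h.card_eq_sum]
  refine (sum_le_card_nsmul _ _ l fun i _ =>
    hl _ (filter_subset _ _) (h.isClique_compl_fiber i)).trans ?_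
  simp [mul_comm]

lemma ProperOn.card_fiber_eq {X : Finset V} {k l : ℕ} {c : V → ℕ} (h : ProperOn G X k c)
    (hl : ∀ S ⊆ X, Gᶜ.IsClique (S : Set V) → #S ≤ l) (hX : #X = l * k) {i : ℕ} (hi : i < k) :
    #{u ∈ X | c u = i} = l := by
  have hle : ∀ i ∈ range k, #{u ∈ X | c u = i} ≤ l := fun i _ =>
    hl _ (filter_subset _ _) (h.isClique_compl_fiber i)
  have hsum : ∑ i ∈ range k, #{u ∈ X | c u = i} = ∑ _i ∈ range k, l := by
    rw [← h.card_eq_sum, hX]; simp [mul_comm]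
  exact (sum_eq_sum_iff_of_le hle).1 hsum i (mem_range.2 hi)

lemma card_filter_mem_eq_mul {X : Finset V} {d : V → ℕ} {I : Finset ℕ} {k : ℕ}
    (h : ∀ i ∈ I, #{u ∈ X | d u = i} = k) : #{u ∈ X | d u ∈ I} = #I * k := by
  have hmaps : Set.MapsTo d ({u ∈ X | d u ∈ I} : Finset V) (I : Set ℕ) := fun u hu =>
    (mem_filter.1 (mem_coe.1 hu)).2
  rw [card_eq_sum_card_fiberwise hmaps]
  refine sum_const_nat fun i hi => ?_
  rw [← h i hi, filter_filter]
  congr 1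
  exact filter_congr fun u _ => ⟨fun hu => hu.2, fun hu => ⟨hu ▸ hi, hu⟩⟩

variable [DecidableEq V]

lemma card_inter_le_one {K S : Finset V} (hK : G.IsClique (K : Set V))
    (hS : Gᶜ.IsClique (S : Set V)) : #(K ∩ S) ≤ 1 := by
  refine card_le_one.2 fun u hu v hv => ?_
  rw [mem_inter] at hu hv
  by_contra hne
  exact ((SimpleGraph.compl_adj ..).1 (hS hu.2 hv.2 hne)).2 (hK hu.1 hv.1 hne)

lemma exists_max_clique (G : SimpleGraph V) (X : Finset V) :
    ∃ K ⊆ X, G.IsClique (K : Set V) ∧ ∀ Q ⊆ X, G.IsClique (Q : Set V) → #Q ≤ #K := by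
  classical
  obtain ⟨K, hK, hmax⟩ := exists_max_image ({Q ∈ X.powerset | G.IsClique (Q : Set V)} :
    Finset (Finset V)) card
    ⟨∅, by simp⟩
  simp only [mem_filter, mem_powerset] at hK hmax
  exact ⟨K, hK.1, hK.2, fun Q hQ hQ' => hmax Q ⟨hQ, hQ'⟩⟩

/-- Removing a stable set from a minimal set that is not clique-colourable does not decrease the
clique number. -/
lemma exists_max_clique_sdiff {X K S : Finset V} (hX : ∀ Y ⊂ X, CliqueColorable G Y)
    (hbad : ¬ CliqueColorable G X) (hKX : K ⊆ X) (hK : G.IsClique (K : Set V))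
    (hmax : ∀ Q ⊆ X, G.IsClique (Q : Set V) → #Q ≤ #K) (hSX : S ⊆ X)
    (hS : Gᶜ.IsClique (S : Set V)) :
    ∃ Q ⊆ X, G.IsClique (Q : Set V) ∧ #Q = #K ∧ Disjoint Q S := by
  rcases S.eq_empty_or_nonempty with rfl | hne
  · exact ⟨K, hKX, hK, rfl, disjoint_empty_right _⟩
  obtain ⟨Q, hQ, hQc, c, hc⟩ := hX (X \ S) (sdiff_ssubset hSX hne)
  have hQX : Q ⊆ X := hQ.trans sdiff_subset
  refine ⟨Q, hQX, hQc, ?_, disjoint_left.2 fun u hu => (mem_sdiff.1 (hQ hu)).2⟩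
  by_contra hne'
  have hlt : #Q < #K := lt_of_le_of_ne (hmax Q hQX hQc) hne'
  refine hbad ⟨K, hKX, hK, fun u => if u ∈ S then #Q else c u, fun v hv => ?_,
    fun u hu v hv hadj => ?_⟩
  · by_cases hvS : v ∈ S
    · simpa [hvS] using hlt
    · simpa [hvS] using (hc.1 v (mem_sdiff.2 ⟨hv, hvS⟩)).trans hlt
  · by_cases huS : u ∈ S <;> by_cases hvS : v ∈ S <;> simp only [huS, hvS, if_true, if_false]
    · exact absurd hadj ((SimpleGraph.compl_adj ..).1 (hS huS hvS hadj.ne)).2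
    · exact (hc.1 v (mem_sdiff.2 ⟨hv, hvS⟩)).ne'
    · exact (hc.1 u (mem_sdiff.2 ⟨hu, huS⟩)).ne
    · exact hc.2 u (mem_sdiff.2 ⟨hu, huS⟩) v (mem_sdiff.2 ⟨hv, hvS⟩) hadj

/-- Two families of finite sets whose intersection matrix is `J - I`, of size at least two, have at
most as many members as there are points. -/
lemma card_le_of_card_inter {ι : Type*} [Fintype ι] [DecidableEq ι] (hι : 1 < Fintype.card ι)
    {X : Finset V} (K S : ι → Finset V) (hK : ∀ i, K i ⊆ X)
    (h : ∀ i j, #(K i ∩ S j) = if i = j then 0 else 1) : Fintype.card ι ≤ #X := by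
  have hli : LinearIndependent ℚ (fun i (x : X) => if (x : V) ∈ K i then (1 : ℚ) else 0) := by
    rw [Fintype.linearIndependent_iff]
    intro g hg
    have hg' : ∀ x : X, ∑ i, g i * (if (x : V) ∈ K i then (1 : ℚ) else 0) = 0 := fun x => by
      simpa using congrFun hg x
    have key : ∀ j, ∑ i, g i - g j = 0 := by
      intro j
      have h2 : ∀ i, ∑ x : X, (if (x : V) ∈ S j then (if (x : V) ∈ K i then (1 : ℚ) else 0) else 0)
          = if i = j then 0 else 1 := by
        intro i
        rw [Finset.sum_coe_sort X
          (fun x => if x ∈ S j then (if x ∈ K i then (1 : ℚ) else 0) else 0)]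
        simp_rw [← ite_and]
        rw [← Finset.sum_filter, Finset.sum_const, nsmul_eq_mul, mul_one]
        have : {x ∈ X | x ∈ S j ∧ x ∈ K i} = K i ∩ S j := by
          ext x
          simp only [mem_filter, mem_inter]
          exact ⟨fun hx => ⟨hx.2.2, hx.2.1⟩, fun hx => ⟨hK i hx.1, hx.2, hx.1⟩⟩
        rw [this, h i j]
        split_ifs <;> simp
      have h3 : ∑ i, g i * (if i = j then 0 else 1) = 0 := by
        simp_rw [← h2, Finset.mul_sum]
        rw [Finset.sum_comm]
        refine Finset.sum_eq_zero fun x _ => ?_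
        by_cases hx : (x : V) ∈ S j
        · simpa only [hx, if_true] using hg' x
        · simp [hx]
      have h4 : ∑ i, g i * (if i = j then 0 else 1) = ∑ i, g i - g j := by
        have : ∀ i, g i * (if i = j then (0 : ℚ) else 1) = g i - if i = j then g i else 0 := by
          intro i; split_ifs <;> simp
        simp_rw [this, Finset.sum_sub_distrib]
        simp
      rw [← h4, h3]
    have hsum : ∑ i, g i = Fintype.card ι * ∑ i, g i := by
      conv_lhs => rw [Finset.sum_congr rfl fun j _ => (sub_eq_zero.1 (key j)).symm]
      simp
    have hcard : (1 : ℚ) < Fintype.card ι := by exact_mod_cast hι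
    have h0 : ∑ i, g i = 0 := by
      have : ((Fintype.card ι : ℚ) - 1) * ∑ i, g i = 0 := by linarith
      exact (mul_eq_zero.1 this).resolve_left (by linarith)
    intro j
    have := key j
    linarith
  have := hli.fintype_card_le_finrank
  simpa using this

/-- **Lovász's inequality**: a minimal set that is not clique-colourable has more than `α ω`
vertices. -/
theorem exists_mul_lt_card {X : Finset V} (hX : ∀ Y ⊂ X, CliqueColorable G Y)
    (hbad : ¬ CliqueColorable G X) :
    ∃ α ω : ℕ, (∀ S ⊆ X, Gᶜ.IsClique (S : Set V) → #S ≤ α) ∧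
      (∀ Q ⊆ X, G.IsClique (Q : Set V) → #Q ≤ ω) ∧ α * ω < #X := by
  obtain ⟨K₀, hK₀X, hK₀, hωmax⟩ := exists_max_clique G X
  obtain ⟨S₀, hS₀X, hS₀, hαmax⟩ := exists_max_clique Gᶜ X
  refine ⟨#S₀, #K₀, hαmax, hωmax, ?_⟩
  obtain ⟨x, hx⟩ : X.Nonempty := by
    by_contra hne
    rw [not_nonempty_iff_eq_empty] at hne
    exact hbad ⟨∅, by simp, by simp, fun _ => 0, by simp [hne, ProperOn]⟩
  have hαpos : 0 < #S₀ := lt_of_lt_of_le (by simp) (hαmax {x} (by simpa using hx) (by simp))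
  have hωpos : 0 < #K₀ := lt_of_lt_of_le (by simp) (hωmax {x} (by simpa using hx) (by simp))
  have hcol : ∀ v : S₀, ∃ c, ProperOn G (X.erase v) #K₀ c := by
    intro v
    obtain ⟨Q, hQ, hQc, c, hc⟩ := hX _ (erase_ssubset (hS₀X v.2))
    exact ⟨c, hc.mono (hωmax Q (hQ.trans (erase_subset _ _)) hQc)⟩
  choose c hc using hcol
  let S : Option (S₀ × Fin #K₀) → Finset V := fun o =>
    o.elim S₀ fun p => {u ∈ X.erase p.1 | c p.1 u = p.2}
  have hSX : ∀ o, S o ⊆ X := by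
    rintro (_ | p)
    · exact hS₀X
    · exact (filter_subset _ _).trans (erase_subset _ _)
  have hS : ∀ o, Gᶜ.IsClique (S o : Set V) := by
    rintro (_ | p)
    · exact hS₀
    · exact (hc p.1).isClique_compl_fiber _
  choose K hKX hK hKcard hKS using fun o =>
    exists_max_clique_sdiff hX hbad hK₀X hK₀ hωmax (hSX o) (hS o)
  have hmem : ∀ Q ⊆ X, G.IsClique (Q : Set V) → #Q = #K₀ → ∀ p : S₀ × Fin #K₀,
      Disjoint Q (S (some p)) → (p.1 : V) ∈ Q := by
    intro Q hQX hQ hQcard p hdisj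
    by_contra hp
    have hsub : Q ⊆ X.erase p.1 := subset_erase.2 ⟨hQX, hp⟩
    obtain ⟨u, hu, hcu⟩ := (hc p.1).exists_mem_of_card_eq hQ hsub hQcard p.2.2
    exact disjoint_left.1 hdisj hu (mem_filter.2 ⟨hsub hu, hcu⟩)
  have huniq : ∀ Q ⊆ X, G.IsClique (Q : Set V) → #Q = #K₀ → ∀ o o',
      Disjoint Q (S o) → Disjoint Q (S o') → o = o' := by
    intro Q hQX hQ hQcard o o' ho ho'
    rcases o with _ | ⟨v, i⟩ <;> rcases o' with _ | ⟨w, j⟩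
    · rfl
    · exact absurd w.2 (disjoint_left.1 ho (hmem Q hQX hQ hQcard _ ho'))
    · exact absurd v.2 (disjoint_left.1 ho' (hmem Q hQX hQ hQcard _ ho))
    · have hv := hmem Q hQX hQ hQcard _ ho
      have hw := hmem Q hQX hQ hQcard _ ho'
      have hvw : v = w := Subtype.ext <| card_le_one.1 (card_inter_le_one hQ hS₀) _
        (mem_inter.2 ⟨hv, v.2⟩) _ (mem_inter.2 ⟨hw, w.2⟩)
      subst hvw
      by_contra hne
      have hij : (i : ℕ) ≠ j := fun h => hne (by rw [Fin.ext h])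
      have hQv : G.IsClique ((Q.erase v : Finset V) : Set V) := hQ.subset (by simp)
      have hsub : Q.erase v ⊆ X.erase v := erase_subset_erase _ hQX
      have hle : #(Q.erase v) ≤ #(((range #K₀).erase i).erase j) := by
        refine card_le_card_of_injOn (c v) (fun u hu => ?_) ((hc v).injOn hQv hsub)
        have hu' := mem_erase.1 hu
        simp only [coe_erase, coe_range, Set.mem_sdiff, Set.mem_singleton_iff, Set.mem_Iio]
        refine ⟨⟨(hc v).1 u (hsub hu), fun h => ?_⟩, fun h => ?_⟩
        · exact disjoint_left.1 ho hu'.2 (mem_filter.2 ⟨hsub hu, h⟩)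
        · exact disjoint_left.1 ho' hu'.2 (mem_filter.2 ⟨hsub hu, h⟩)
      have h1 : #(Q.erase (v : V)) = #Q - 1 := card_erase_of_mem hv
      have h2 := card_erase_of_mem (s := range #K₀) (mem_range.2 i.2)
      have h3 := card_erase_of_mem (s := (range #K₀).erase i) (a := (j : ℕ))
        (mem_erase.2 ⟨hij.symm, mem_range.2 j.2⟩)
      rw [card_range] at h2
      have := i.2
      have := j.2
      omega
  have hcard := card_le_of_card_inter (ι := Option (S₀ × Fin #K₀))
    (by simp [hαpos, hωpos, -card_pos]) K S hKX
    (fun o o' => by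
      split_ifs with hoo
      · subst hoo
        exact card_eq_zero.2 (disjoint_iff_inter_eq_empty.1 (hKS o))
      · refine le_antisymm (card_inter_le_one (hK o) (hS o')) ?_
        rw [Nat.one_le_iff_ne_zero, Ne, card_eq_zero, ← disjoint_iff_inter_eq_empty]
        exact fun hd => hoo (huniq _ (hKX o) (hK o) (hKcard o) _ _ (hKS o) hd))
  simpa [Nat.succ_le_iff] using hcard

/-- A form of the weak perfect graph theorem. -/
theorem cliqueColorable_compl (X : Finset V) (hX : ∀ Y ⊆ X, CliqueColorable G Y) :
    CliqueColorable Gᶜ X := by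
  induction X using Finset.strongInduction with
  | H X ih =>
    by_contra hbad
    obtain ⟨α, ω, hα, hω, hlt⟩ := exists_mul_lt_card (G := Gᶜ)
      (fun Y hY => ih Y hY fun Z hZ => hX Z (hZ.trans hY.1)) hbad
    obtain ⟨Q, hQ, hQc, c, hc⟩ := hX X subset_rfl
    rw [compl_compl] at hα
    have h1 := hc.card_le_mul hω
    have h2 := Nat.mul_le_mul_left ω (hα Q hQ hQc)
    rw [mul_comm] at hlt
    omega

lemma cliqueColorable_of_isPerfect {Y : Finset V} (h : IsPerfect (G.induce (Y : Set V))) :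
    CliqueColorable G Y := by
  obtain ⟨t, ht⟩ := ((G.induce (Y : Set V)).induce Set.univ).exists_isNClique_cliqueNum
  obtain ⟨C, hC⟩ := (SimpleGraph.colorable_iff_exists_bdd_nat_coloring _).1
    (SimpleGraph.chromaticNumber_le_iff_colorable.1 (h Set.univ).ge)
  rw [← ht.card_eq] at hC
  have hinj : Function.Injective
      (fun x : (Set.univ : Set (Y : Set V)) => ((x : (Y : Set V)) : V)) :=
    Subtype.val_injective.comp Subtype.val_injective
  refine ⟨t.image fun x : (Set.univ : Set (Y : Set V)) => ((x : (Y : Set V)) : V), ?_, ?_,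
    fun v => if hv : v ∈ Y then C ⟨⟨v, hv⟩, trivial⟩ else 0, ?_⟩
  · intro v hv
    obtain ⟨x, -, rfl⟩ := mem_image.1 hv
    exact x.1.2
  · intro u hu v hv hne
    obtain ⟨x, hx, rfl⟩ := mem_image.1 (mem_coe.1 hu)
    obtain ⟨y, hy, rfl⟩ := mem_image.1 (mem_coe.1 hv)
    exact ht.isClique hx hy fun hxy => hne (by rw [hxy])
  · rw [card_image_of_injective _ hinj]
    refine ⟨fun v hv => by simpa only [hv, dif_pos] using hC _, fun u hu v hv hadj => ?_⟩
    simp only [hu, hv, dif_pos]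
    exact C.valid hadj

lemma CliqueColorable.cliqueNum_eq_chromaticNumber [Finite V] {Y : Finset V}
    (h : CliqueColorable G Y) :
    ((G.induce (Y : Set V)).cliqueNum : ℕ∞) = (G.induce (Y : Set V)).chromaticNumber := by
  obtain ⟨Q, hQY, hQ, c, hc⟩ := h
  refine le_antisymm (G.induce (Y : Set V)).cliqueNum_le_chromaticNumber ?_
  have hcol : (G.induce (Y : Set V)).Colorable #Q :=
    (SimpleGraph.colorable_iff_exists_bdd_nat_coloring _).2
      ⟨SimpleGraph.Coloring.mk (fun v => c v) fun {u v} hadj => hc.2 u u.2 v v.2 hadj,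
        fun v => hc.1 v v.2⟩
  refine hcol.chromaticNumber_le.trans (Nat.cast_le.2 ?_)
  have hclique : (G.induce (Y : Set V)).IsClique
      ((Q.subtype (· ∈ (Y : Set V)) : Finset (Y : Set V)) : Set (Y : Set V)) := by
    intro u hu v hv hne
    rw [mem_coe, mem_subtype] at hu hv
    exact hQ hu hv fun huv => hne (Subtype.ext huv)
  have hle := SimpleGraph.IsClique.card_le_cliqueNum (tc := hclique)
  rwa [card_subtype, filter_true_of_mem fun v hv => mem_coe.2 (hQY hv)] at hle

end

section

open Finset

variable {V : Type*} [Fintype V] [DecidableEq V] {G : SimpleGraph V}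

/-- Lovász: for some `α` and `ω` bounding the stable sets and the cliques of a minimally imperfect
graph, the graph has `α ω + 1` vertices, and removing any vertex leaves a graph with an
`ω`-colouring and a cover by `α` cliques. -/
theorem MinimallyImperfect.exists_partitions (h : MinimallyImperfect G) :
    ∃ α ω : ℕ, 0 < ω ∧ (∀ S : Finset V, Gᶜ.IsClique (S : Set V) → #S ≤ α) ∧
      (∀ Q : Finset V, G.IsClique (Q : Set V) → #Q ≤ ω) ∧
      (∀ v : V, #(univ.erase v) = α * ω) ∧ (∀ v, ∃ c, ProperOn G (univ.erase v) ω c) ∧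
      ∀ v, ∃ d, ProperOn Gᶜ (univ.erase v) α d := by
  classical
  have hgood : ∀ Y ⊂ (univ : Finset V), CliqueColorable G Y := fun Y hY =>
    cliqueColorable_of_isPerfect (h.2 _ fun hYu => hY.ne (by simpa using hYu))
  have hbad : ¬ CliqueColorable G (univ : Finset V) := by
    intro hu
    refine h.1 fun S => ?_
    obtain ⟨Y, rfl⟩ : ∃ Y : Finset V, (Y : Set V) = S := ⟨S.toFinset, by simp⟩
    refine CliqueColorable.cliqueNum_eq_chromaticNumber ?_
    by_cases hY : Y = univ
    · rwa [hY]
    · exact hgood _ (ssubset_univ_iff.2 hY)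
  obtain ⟨α, ω, hα, hω, hlt⟩ := exists_mul_lt_card hgood hbad
  replace hα : ∀ S : Finset V, Gᶜ.IsClique (S : Set V) → #S ≤ α := fun S => hα S (subset_univ S)
  replace hω : ∀ Q : Finset V, G.IsClique (Q : Set V) → #Q ≤ ω := fun Q => hω Q (subset_univ Q)
  have hcol : ∀ v, ∃ c, ProperOn G (univ.erase v) ω c := fun v => by
    obtain ⟨Q, -, hQ, c, hc⟩ := hgood _ (erase_ssubset (mem_univ v))
    exact ⟨c, hc.mono (hω Q hQ)⟩
  obtain ⟨x, -⟩ : (univ : Finset V).Nonempty := card_pos.1 (by omega)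
  refine ⟨α, ω, lt_of_lt_of_le (by simp) (hω {x} (by simp)), hα, hω, fun v => ?_, hcol,
    fun v => ?_⟩
  · obtain ⟨c, hc⟩ := hcol v
    refine le_antisymm (hc.card_le_mul fun S _ => hα S) ?_
    rw [card_erase_of_mem (mem_univ v)]
    omega
  · obtain ⟨Q, -, hQ, d, hd⟩ := cliqueColorable_compl (G := G) (univ.erase v) fun Y hY =>
      hgood Y (hY.trans_ssubset (erase_ssubset (mem_univ v)))
    exact ⟨d, hd.mono (hα Q hQ)⟩

/-- A weight of sum `0` on the members of `P` avoiding `a`, and of sum `0` or `-1` on the others,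
vanishes outside `a`, provided that all vertex-deleted subsets can be partitioned into members
of `P`. -/
lemma eq_zero_of_sum_eq_zero {P : Finset V → Prop} {ω : ℕ}
    (hP : ∀ v, ∃ c : V → ℕ, (∀ u ∈ univ.erase v, c u < ω) ∧
      ∀ i < ω, P {u ∈ univ.erase v | c u = i})
    {z : V → ℤ} {a : V} (hz : z a = 0 ∨ z a = -1)
    (h₀ : ∀ T, P T → a ∉ T → ∑ u ∈ T, z u = 0)
    (h₁ : ∀ T, P T → a ∈ T → ∑ u ∈ T, z u = 0 ∨ ∑ u ∈ T, z u = -1) {u : V} (hu : u ≠ a) :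
    z u = 0 := by
  have hfib : ∀ (v : V) (c : V → ℕ), (∀ u ∈ univ.erase v, c u < ω) →
      ∑ u ∈ univ.erase v, z u = ∑ i ∈ range ω, ∑ u ∈ univ.erase v with c u = i, z u :=
    fun v c hc => (sum_fiberwise_of_maps_to (fun u hu => mem_range.2 (hc u hu)) z).symm
  have hadd : ∀ v, z v + ∑ u ∈ univ.erase v, z u = ∑ u, z u := fun v =>
    add_sum_erase univ z (mem_univ v)
  have ha : ∑ u ∈ univ.erase a, z u = 0 := by
    obtain ⟨c, hc, hT⟩ := hP a
    rw [hfib a c hc]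
    exact sum_eq_zero fun i hi => h₀ _ (hT i (mem_range.1 hi)) (by simp)
  have hne : ∀ v ≠ a, ∑ u ∈ univ.erase v, z u = 0 ∨ ∑ u ∈ univ.erase v, z u = -1 := by
    intro v hv
    obtain ⟨c, hc, hT⟩ := hP v
    have hav : a ∈ univ.erase v := mem_erase.2 ⟨hv.symm, mem_univ a⟩
    rw [hfib v c hc, sum_eq_single (c a)
      (fun i hi hia => h₀ _ (hT i (mem_range.1 hi)) fun h => hia (mem_filter.1 h).2.symm)
      (fun h => absurd (mem_range.2 (hc a hav)) h)]
    exact h₁ _ (hT _ (hc a hav)) (mem_filter.2 ⟨hav, rfl⟩)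
  have hval : ∀ v ≠ a, z v = z a ∨ z v = z a + 1 := by
    intro v hv
    have h1 := hadd v
    have h2 := hadd a
    rcases hne v hv with h | h <;> omega
  have hua : u ∈ univ.erase a := mem_erase.2 ⟨hu, mem_univ u⟩
  rcases hz with hz | hz
  · refine (sum_eq_zero_iff_of_nonneg fun v hv => ?_).1 ha u hua
    rcases hval v (mem_erase.1 hv).1 with h | h <;> omega
  · refine (sum_eq_zero_iff_of_nonpos fun v hv => ?_).1 ha u hua
    rcases hval v (mem_erase.1 hv).1 with h | h <;> omega

/-- Two sets that agree outside the complete pair `A, B` and meet maximum stable sets in the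
expected number of vertices agree on `A`, except possibly in `a`. -/
lemma mem_iff_mem_of_card_inter {α ω k : ℕ}
    (hP : ∀ v, ∃ c : V → ℕ, (∀ u ∈ univ.erase v, c u < ω) ∧
      ∀ i < ω, Gᶜ.IsNClique α {u ∈ univ.erase v | c u = i})
    {A B : Set V} (hAB : ∀ a ∈ A, ∀ b ∈ B, G.Adj a b) {a b : V} (ha : a ∈ A) (hb : b ∈ B)
    {M N : Finset V} (hMN : ∀ u, u ∉ A → u ∉ B → (u ∈ M ↔ u ∈ N)) (haM : a ∉ M)
    (hM₀ : ∀ T, Gᶜ.IsNClique α T → a ∉ T → #(T ∩ M) = k)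
    (hM₁ : ∀ T, Gᶜ.IsNClique α T → a ∈ T → #(T ∩ M) = k ∨ #(T ∩ M) + 1 = k)
    (hN : ∀ T, Gᶜ.IsNClique α T → b ∉ T → #(T ∩ N) = k) {u : V} (hu : u ∈ A) (hua : u ≠ a) :
    u ∈ M ↔ u ∈ N := by
  classical
  let z : V → ℤ := fun u => if u ∈ A then (if u ∈ M then 1 else 0) - (if u ∈ N then 1 else 0) else 0
  have hsum : ∀ T, Gᶜ.IsNClique α T → ∑ u ∈ T, z u = 0 ∨
      b ∉ T ∧ ∑ u ∈ T, z u = (#(T ∩ M) : ℤ) - #(T ∩ N) := by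
    intro T hT
    by_cases hTA : ∃ w ∈ T, w ∈ A
    · obtain ⟨w, hwT, hwA⟩ := hTA
      have hTB : ∀ v ∈ T, v ∉ B := fun v hv hvB =>
        ((SimpleGraph.compl_adj ..).1 (hT.isClique hwT hv (hAB w hwA v hvB).ne)).2
          (hAB w hwA v hvB)
      refine Or.inr ⟨fun h => hTB b h hb, ?_⟩
      have hz : ∀ v ∈ T, z v = (if v ∈ M then 1 else 0) - (if v ∈ N then 1 else 0) := by
        intro v hv
        by_cases hvA : v ∈ A
        · simp only [z, hvA, if_true]
        · simp only [z, hvA, if_false, hMN v hvA (hTB v hv), sub_self]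
      rw [sum_congr rfl hz, sum_sub_distrib]
      simp
    · exact Or.inl (sum_eq_zero fun v hv => if_neg fun hvA => hTA ⟨v, hv, hvA⟩)
  have hzu : z u = 0 := by
    refine eq_zero_of_sum_eq_zero hP (a := a) ?_ (fun T hT haT => ?_) (fun T hT haT => ?_) hua
    · by_cases haN : a ∈ N <;> simp [z, ha, haM, haN]
    · rcases hsum T hT with h | ⟨hbT, h⟩
      · exact h
      · rw [h, hM₀ T hT haT, hN T hT hbT, sub_self]
    · rcases hsum T hT with h | ⟨hbT, h⟩
      · exact Or.inl h
      · have h1 := hM₁ T hT haT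
        have h2 := hN T hT hbT
        omega
  by_cases huM : u ∈ M <;> by_cases huN : u ∈ N <;> simp_all [z]

lemma ProperOn.card_inter_eq {α : ℕ} {v : V} {d : V → ℕ} {I : Finset ℕ} {T : Finset V}
    (hd : ProperOn Gᶜ (univ.erase v) α d) (hI : I ⊆ range α) (hT : Gᶜ.IsNClique α T)
    (hv : v ∉ T) : #(T ∩ {u ∈ univ.erase v | d u ∈ I}) = #I := by
  have hsub : T ⊆ univ.erase v := subset_erase.2 ⟨subset_univ T, hv⟩
  rw [← hd.card_filter_eq hT.isClique hsub hT.card_eq hI, inter_filter, inter_eq_left.2 hsub]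

lemma ProperOn.card_inter_eq_or {α : ℕ} {v : V} {d : V → ℕ} {I : Finset ℕ} {T : Finset V}
    (hd : ProperOn Gᶜ (univ.erase v) α d) (hI : I ⊆ range α) (hT : Gᶜ.IsNClique α T)
    (hv : v ∈ T) : #(T ∩ {u ∈ univ.erase v | d u ∈ I}) = #I ∨
      #(T ∩ {u ∈ univ.erase v | d u ∈ I}) + 1 = #I := by
  have hsub : T.erase v ⊆ univ.erase v := erase_subset_erase _ (subset_univ T)
  have hcl : Gᶜ.IsClique ((T.erase v : Finset V) : Set V) := hT.isClique.subset (by simp)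
  have heq : T ∩ {u ∈ univ.erase v | d u ∈ I} = {u ∈ T.erase v | d u ∈ I} := by
    ext u; simp only [mem_inter, mem_filter, mem_erase, mem_univ]; tauto
  have h1 := hd.card_filter_le (I := I) hcl hsub
  have h2 := hd.card_filter_le (I := range α \ I) hcl hsub
  have h3 : {u ∈ T.erase v | d u ∈ range α \ I} = {u ∈ T.erase v | d u ∉ I} :=
    filter_congr fun u hu => by simp [hd.1 u (hsub hu)]
  have h4 := card_filter_add_card_filter_not (s := T.erase v) (fun u => d u ∈ I)
  rw [card_erase_of_mem hv, hT.card_eq] at h4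
  rw [h3, card_sdiff_of_subset hI, card_range] at h2
  have h5 := card_le_card hI
  rw [card_range] at h5
  have h6 := card_pos.2 ⟨v, hv⟩
  rw [hT.card_eq] at h6
  rw [heq]
  omega

/-- In a graph whose vertex-deleted subgraphs are partitioned into `ω` stable sets of size `α`,
every clique of size `ω` is disjoint from one of these stable sets. -/
lemma exists_isNClique_compl_disjoint {α ω : ℕ} (hω : 0 < ω)
    (hP : ∀ v, ∃ c : V → ℕ, (∀ u ∈ univ.erase v, c u < ω) ∧
      ∀ i < ω, Gᶜ.IsNClique α {u ∈ univ.erase v | c u = i})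
    {Q : Finset V} (hQ : #Q = ω) : ∃ T, Gᶜ.IsNClique α T ∧ Disjoint Q T := by
  obtain ⟨q, hq⟩ : Q.Nonempty := card_pos.1 (by omega)
  obtain ⟨c, -, hT⟩ := hP q
  obtain ⟨i, hi, hiQ⟩ : ∃ i ∈ range ω, i ∉ (Q.erase q).image c := by
    refine exists_mem_notMem_of_card_lt_card (card_image_le.trans_lt ?_)
    rw [card_erase_of_mem hq, card_range]
    omega
  refine ⟨_, hT i (mem_range.1 hi), disjoint_left.2 fun u hu huT => hiQ ?_⟩
  obtain ⟨huq, hui⟩ := mem_filter.1 huT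
  exact mem_image.2 ⟨u, mem_erase.2 ⟨(mem_erase.1 huq).1, hu⟩, hui⟩

/-- A nonempty union of members of the clique partition obtained by deleting `a` cannot be a union
of members of the clique partition obtained by deleting a neighbour of `a`. -/
lemma ProperOn.exists_card_inter_ne {α ω : ℕ} (hω : 0 < ω)
    (hP : ∀ v, ∃ c : V → ℕ, (∀ u ∈ univ.erase v, c u < ω) ∧
      ∀ i < ω, Gᶜ.IsNClique α {u ∈ univ.erase v | c u = i})
    {a b : V} (hab : G.Adj a b) {d : V → ℕ} {I : Finset ℕ}
    (hd : ProperOn Gᶜ (univ.erase a) α d)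
    (hdω : ∀ i < α, #{u ∈ univ.erase a | d u = i} = ω) (hI : I ⊆ range α) (hne : I.Nonempty) :
    ∃ T, Gᶜ.IsNClique α T ∧ b ∉ T ∧ #(T ∩ {u ∈ univ.erase a | d u ∈ I}) ≠ #I := by
  obtain ⟨i, hi⟩ := hne
  have hiα := mem_range.1 (hI hi)
  obtain ⟨T, hT, hdisj⟩ := exists_isNClique_compl_disjoint hω hP (hdω i hiα)
  have haT : a ∈ T := by
    by_contra haT
    have hsub : T ⊆ univ.erase a := subset_erase.2 ⟨subset_univ T, haT⟩
    obtain ⟨u, hu, hui⟩ := hd.exists_mem_of_card_eq hT.isClique hsub hT.card_eq hiα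
    exact disjoint_left.1 hdisj (mem_filter.2 ⟨hsub hu, hui⟩) hu
  refine ⟨T, hT, fun hbT => ?_, ne_of_lt ?_⟩
  · exact ((SimpleGraph.compl_adj ..).1 (hT.isClique haT hbT hab.ne)).2 hab
  · have hcl : Gᶜ.IsClique ((T.erase a : Finset V) : Set V) := hT.isClique.subset (by simp)
    have hle := hd.card_filter_le (I := I.erase i) hcl (erase_subset_erase _ (subset_univ T))
    rw [card_erase_of_mem hi] at hle
    have hpos := card_pos.2 ⟨i, hi⟩
    refine lt_of_le_of_lt (card_le_card fun u hu => ?_) (lt_of_le_of_lt hle (by omega))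
    obtain ⟨huT, hu⟩ := mem_inter.1 hu
    obtain ⟨hua, huI⟩ := mem_filter.1 hu
    refine mem_filter.2 ⟨mem_erase.2 ⟨(mem_erase.1 hua).1, huT⟩, mem_erase.2 ⟨fun h => ?_, huI⟩⟩
    exact disjoint_left.1 hdisj (mem_filter.2 ⟨hua, h⟩) huT

/-- If a maximum stable set `s` avoids `v` and lies in `C ∪ D`, with no edges between `C` and `D`,
then the members of the clique partition of `G - v` that meet `s` in `C` are those that meet `C`,
and they avoid `D`. -/
lemma ProperOn.exists_colors_of_separated {α : ℕ} {v : V} {d : V → ℕ} {s t : Finset V}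
    {C D : Set V} (hd : ProperOn Gᶜ (univ.erase v) α d) (hs : Gᶜ.IsNClique α s)
    (hsCD : ∀ u ∈ s, u ∈ C ∨ u ∈ D) (ht : ∀ u, u ∈ t ↔ u ∈ s ∧ u ∈ C) (hCD : Disjoint C D)
    (hadj : ∀ c ∈ C, ∀ d ∈ D, ¬ G.Adj c d) (hvC : v ∉ C) (hvD : v ∉ D) :
    ∃ I ⊆ range α, #I = #t ∧ (∀ u ∈ C, d u ∈ I) ∧ ∀ u ∈ D, d u ∉ I := by
  have hne : ∀ u, u ∈ C ∨ u ∈ D → u ∈ univ.erase v := fun u hu =>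
    mem_erase.2 ⟨fun h => by subst h; tauto, mem_univ u⟩
  have hsub : s ⊆ univ.erase v := fun u hu => hne u (hsCD u hu)
  have hcd : ∀ x ∈ C, ∀ y ∈ D, d x ≠ d y := fun x hx y hy =>
    hd.2 x (hne x (Or.inl hx)) y (hne y (Or.inr hy))
      ((SimpleGraph.compl_adj ..).2 ⟨fun h => Set.disjoint_left.1 hCD hx (h ▸ hy), hadj x hx y hy⟩)
  refine ⟨t.image d, fun i hi => ?_, ?_, fun u hu => ?_, fun u hu hi => ?_⟩
  · obtain ⟨u, hu, rfl⟩ := mem_image.1 hi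
    exact mem_range.2 (hd.1 u (hsub ((ht u).1 hu).1))
  · exact card_image_of_injOn
      ((hd.injOn hs.isClique hsub).mono fun u hu => ((ht u).1 (mem_coe.1 hu)).1)
  · obtain ⟨w, hw, hwu⟩ := hd.exists_mem_of_card_eq hs.isClique hsub hs.card_eq
      (hd.1 u (hne u (Or.inl hu)))
    refine mem_image.2 ⟨w, (ht w).2 ⟨hw, (hsCD w hw).resolve_right fun hwD => ?_⟩, hwu⟩
    exact hcd u hu w hwD hwu.symm
  · obtain ⟨w, hw, hwu⟩ := mem_image.1 hi
    exact hcd w ((ht w).1 hw).2 u hu hwu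

end

/-- In a minimally imperfect graph with skew partition `A, B, C, D`, every stable
set of cardinality `α(G)` intersects `A ∪ B`. -/
theorem max_stable_set_meets_A_union_B {V : Type*} [Fintype V] (G : SimpleGraph V)
    (A B C D : Set V) (hmi : MinimallyImperfect G)
    (hsp : IsSkewPartition G A B C D) :
    ∀ s : Finset V, Gᶜ.IsNClique (stableNum G) s →
      ((s : Set V) ∩ (A ∪ B)).Nonempty := by
  classical
  intro s hs
  obtain ⟨α, ω, hω₀, hα, hω, hcard, hc, hd⟩ := hmi.exists_partitions
  obtain ⟨⟨a, ha⟩, ⟨b, hb⟩, ⟨x, hx⟩, ⟨y, hy⟩, hcov, -, hAC, hAD, hBC, hBD, hCD, hAB, hadj⟩ := hsp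
  have hP : ∀ v, ∃ c : V → ℕ, (∀ u ∈ Finset.univ.erase v, c u < ω) ∧
      ∀ i < ω, Gᶜ.IsNClique α {u ∈ Finset.univ.erase v | c u = i} := fun v => by
    obtain ⟨c, hc⟩ := hc v
    exact ⟨c, hc.1, fun i hi => ⟨hc.isClique_compl_fiber i,
      hc.card_fiber_eq (fun S _ => hα S) (hcard v) hi⟩⟩
  choose d hd using hd
  have hdω : ∀ v, ∀ i < α, (Finset.univ.erase v |>.filter fun u => d v u = i).card = ω :=
    fun v i hi => (hd v).card_fiber_eq (fun Q _ hQ => hω Q (by rwa [compl_compl] at hQ))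
      (by rw [hcard v, mul_comm]) hi
  have hsα : Gᶜ.IsNClique α s := by
    refine ⟨hs.isClique, le_antisymm (hα s hs.isClique) ?_⟩
    obtain ⟨c, -, hT⟩ := hP a
    rw [hs.card_eq, ← (hT 0 hω₀).card_eq]
    exact SimpleGraph.IsClique.card_le_cliqueNum (tc := (hT 0 hω₀).isClique)
  by_contra hempty
  have hmem : ∀ u, u ∉ A → u ∉ B → u ∈ C ∨ u ∈ D := fun u huA huB => by
    have hu : u ∈ A ∪ B ∪ C ∪ D := hcov ▸ Set.mem_univ u
    simp only [Set.mem_union] at hu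
    tauto
  have hsCD : ∀ u ∈ s, u ∈ C ∨ u ∈ D := fun u hu =>
    hmem u (fun h => hempty ⟨u, hu, Or.inl h⟩) fun h => hempty ⟨u, hu, Or.inr h⟩
  have hcolors := fun v => (hd v).exists_colors_of_separated hsα hsCD
    (t := s.filter (· ∈ C)) (fun u => Finset.mem_filter) hCD hadj
  obtain ⟨I, hI, hIk, hIC, hID⟩ := hcolors a (Set.disjoint_left.1 hAC ha)
    (Set.disjoint_left.1 hAD ha)
  obtain ⟨J, hJ, hJk, hJC, hJD⟩ := hcolors b (Set.disjoint_left.1 hBC hb)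
    (Set.disjoint_left.1 hBD hb)
  have hIJ : I.card = J.card := hIk.trans hJk.symm
  have hadj_ab := hAB a ha b hb
  set M : Finset V := {u ∈ Finset.univ.erase a | d a u ∈ I} with hM
  set N : Finset V := {u ∈ Finset.univ.erase b | d b u ∈ J} with hN
  have haM : a ∉ M := by simp [hM]
  have hbN : b ∉ N := by simp [hN]
  have hMN : ∀ u, u ∉ A → u ∉ B → (u ∈ M ↔ u ∈ N) := by
    intro u huA huB
    have hua : u ≠ a := fun h => huA (h ▸ ha)
    have hub : u ≠ b := fun h => huB (h ▸ hb)
    simp only [hM, hN, Finset.mem_filter, Finset.mem_erase, Finset.mem_univ, ne_eq, hua, hub,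
      not_false_eq_true, true_and]
    rcases hmem u huA huB with h | h
    · simp only [hIC u h, hJC u h]
    · simp only [hID u h, hJD u h]
  have hM₀ := fun T hT => (hd a).card_inter_eq (T := T) hI hT
  have hN₀ := fun T hT => (hd b).card_inter_eq (T := T) hJ hT
  have hM₁ := fun T hT => (hd a).card_inter_eq_or (T := T) hI hT
  have hN₁ := fun T hT => (hd b).card_inter_eq_or (T := T) hJ hT
  have hagree : ∀ u, u ≠ a → u ≠ b → (u ∈ M ↔ u ∈ N) := by
    intro u hua hub
    by_cases huA : u ∈ A
    · exact mem_iff_mem_of_card_inter hP hAB ha hb hMN haM hM₀ hM₁ (by rwa [hIJ]) huA hua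
    by_cases huB : u ∈ B
    · exact (mem_iff_mem_of_card_inter hP (fun b hb a ha => (hAB a ha b hb).symm) hb ha
        (fun u huB huA => (hMN u huA huB).symm) hbN hN₀ hN₁ (by rwa [← hIJ]) huB hub).symm
    exact hMN u huA huB
  have hcardM : M.card = N.card := by
    rw [hM, hN, card_filter_mem_eq_mul fun i hi => hdω a i (Finset.mem_range.1 (hI hi)),
      card_filter_mem_eq_mul fun i hi => hdω b i (Finset.mem_range.1 (hJ hi)), hIJ]
  have hbM : b ∈ M ↔ a ∈ N := by
    have hne := hadj_ab.ne
    constructor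
    · intro hbM
      by_contra haN
      refine hcardM.not_gt (Finset.card_lt_card ⟨fun u hu => ?_, fun h => hbN (h hbM)⟩)
      exact (hagree u (fun h => haN (h ▸ hu)) fun h => hbN (h ▸ hu)).2 hu
    · intro haN
      by_contra hbM
      refine hcardM.not_lt (Finset.card_lt_card ⟨fun u hu => ?_, fun h => haM (h haN)⟩)
      exact (hagree u (fun h => haM (h ▸ hu)) fun h => hbM (h ▸ hu)).1 hu
  by_cases haN : a ∈ N
  · have hbM' := hbM.2 haN
    obtain ⟨T, hT, hbT, hTI⟩ := (hd a).exists_card_inter_ne hω₀ hP hadj_ab (hdω a)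
      (Finset.sdiff_subset (s := Finset.range α) (t := I))
      ⟨d a y, Finset.mem_sdiff.2 ⟨Finset.mem_range.2 ((hd a).1 y (Finset.mem_erase.2
        ⟨fun h => Set.disjoint_left.1 hAD ha (h ▸ hy), Finset.mem_univ y⟩)), hID y hy⟩⟩
    have hcompl : ∀ v (K : Finset ℕ) (u : V),
        u ∈ (Finset.univ.erase v |>.filter fun u => d v u ∈ Finset.range α \ K) ↔
          u ≠ v ∧ u ∉ (Finset.univ.erase v |>.filter fun u => d v u ∈ K) := by
      intro v K u
      have hu := (hd v).1 u
      simp only [Finset.mem_filter, Finset.mem_erase, Finset.mem_univ, Finset.mem_sdiff,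
        Finset.mem_range, and_true] at hu ⊢
      tauto
    refine hTI ?_
    have heq : (Finset.univ.erase a |>.filter fun u => d a u ∈ Finset.range α \ I) =
        (Finset.univ.erase b |>.filter fun u => d b u ∈ Finset.range α \ J) := by
      ext u
      rw [hcompl a I u, hcompl b J u]
      by_cases hua : u = a
      · subst hua; tauto
      by_cases hub : u = b
      · subst hub; tauto
      have := hagree u hua hub
      tauto
    rw [heq, (hd b).card_inter_eq Finset.sdiff_subset hT hbT, Finset.card_sdiff_of_subset hI,
      Finset.card_sdiff_of_subset hJ, hIJ]
  · obtain ⟨T, hT, hbT, hTI⟩ := (hd a).exists_card_inter_ne hω₀ hP hadj_ab (hdω a) hI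
      ⟨d a x, hIC x hx⟩
    have heq : M = N := by
      ext u
      by_cases hua : u = a
      · subst hua; tauto
      by_cases hub : u = b
      · subst hub; tauto
      exact hagree u hua hub
    rw [← hM, heq, hN₀ T hT hbT] at hTI
    exact hTI hIJ.symm
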